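/- Let T > 0, η > 0, γ ≥ 0, and let λ, ρ : [0,T] → [0,∞) be bounded measurable functions. Define f : [0,T) × ℝ³ → ℝ³ by f(t,(h,g,p)) = ( (T−t)²λ(t) − η⁻¹(h/(T−t) − γ(T−t+g))² + 2γ(T−t+g) , −ρ(t)(T−t+g) + η⁻¹(γp − g/(T−t))(h/(T−t) − γ(T−t+g)) + γp , −2ρ(t)p − η⁻¹(γp − g/(T−t))² ). Then there exist δ ∈ (0,T] and a continuous function Y : [T−δ,T] → ℝ³ with sup_{t ∈ [T−δ,T)} (T−t)⁻²·|Y(t)| < ∞ such that Y(t) = ∫ₜᵀ f(s, Y(s)) ds for all t ∈ [T−δ,T]. -/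

import Mathlib

open Set MeasureTheory intervalIntegral

/-- Global existence for the backward Carathéodory equation `Y t = ∫ s in t..b, F s (Y s)` on a
short interval, for a bounded measurable right-hand side that is uniformly Lipschitz in space. -/
theorem exists_continuous_eq_integral_of_lipschitz {n : ℕ} {a b : ℝ} (hab : a ≤ b)
    (F : ℝ → (Fin n → ℝ) → (Fin n → ℝ)) (hF : Measurable (Function.uncurry F)) {L M : ℝ}
    (hL0 : 0 ≤ L) (hL : L * (b - a) < 1)
    (hLip : ∀ t ∈ Icc a b, ∀ y z, ‖F t y - F t z‖ ≤ L * ‖y - z‖)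
    (hM : ∀ t ∈ Icc a b, ∀ y, ‖F t y‖ ≤ M) :
    ∃ Y : ℝ → Fin n → ℝ, Continuous Y ∧ ∀ t ∈ Icc a b, Y t = ∫ s in t..b, F s (Y s) := by
  have hint : ∀ Y : ℝ → Fin n → ℝ, Continuous Y →
      IntegrableOn (fun s => F s (Y s)) (Icc a b) volume := by
    intro Y hY
    refine Measure.integrableOn_of_bounded (M := M) (by simp)
      (hF.comp (measurable_id.prodMk hY.measurable)).aestronglyMeasurable ?_
    filter_upwards [ae_restrict_mem measurableSet_Icc] with s hs using hM s hs _
  have hii : ∀ Y : ℝ → Fin n → ℝ, Continuous Y → ∀ t ∈ Icc a b,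
      IntervalIntegrable (fun s => F s (Y s)) volume t b := by
    intro Y hY t ht
    refine ((hint Y hY).mono_set ?_).intervalIntegrable
    rw [uIcc_of_le ht.2]
    exact Icc_subset_Icc_left ht.1
  have hcont : ∀ Y : ℝ → Fin n → ℝ, Continuous Y →
      ContinuousOn (fun t => ∫ s in t..b, F s (Y s)) (Icc a b) := by
    intro Y hY
    have h := intervalIntegral.continuousOn_primitive_interval_left (μ := volume)
      (f := fun s => F s (Y s)) (a := a) (b := b) (by rw [uIcc_of_le hab]; exact hint Y hY)
    rwa [uIcc_of_le hab] at h
  have hext : ∀ Y : C(Icc a b, Fin n → ℝ), Continuous (IccExtend hab Y) :=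
    fun Y => Y.continuous.Icc_extend'
  let Φ : C(Icc a b, Fin n → ℝ) → C(Icc a b, Fin n → ℝ) := fun Y =>
    ⟨fun t => ∫ s in (t : ℝ)..b, F s (IccExtend hab Y s), (hcont _ (hext Y)).domRestrict⟩
  have hcontr : ContractingWith (L * (b - a)).toNNReal Φ := by
    have hK : 0 ≤ L * (b - a) := mul_nonneg hL0 (sub_nonneg.2 hab)
    refine ⟨by simpa using hL, LipschitzWith.of_dist_le_mul fun Y Z => ?_⟩
    rw [Real.coe_toNNReal _ hK, ContinuousMap.dist_le (mul_nonneg hK dist_nonneg)]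
    intro t
    have hd : ∀ s ∈ uIoc (t : ℝ) b,
        ‖F s (IccExtend hab Y s) - F s (IccExtend hab Z s)‖ ≤ L * dist Y Z := by
      intro s hs
      rw [uIoc_of_le t.2.2] at hs
      refine (hLip s ⟨t.2.1.trans hs.1.le, hs.2⟩ _ _).trans ?_
      gcongr
      rw [← dist_eq_norm]
      exact ContinuousMap.dist_apply_le_dist _
    change dist (∫ s in (t : ℝ)..b, F s (IccExtend hab Y s))
      (∫ s in (t : ℝ)..b, F s (IccExtend hab Z s)) ≤ _
    rw [dist_eq_norm, ← intervalIntegral.integral_sub (hii _ (hext Y) t t.2)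
      (hii _ (hext Z) t t.2)]
    refine (intervalIntegral.norm_integral_le_of_norm_le_const hd).trans ?_
    rw [abs_of_nonneg (sub_nonneg.2 t.2.2)]
    have h1 : b - t ≤ b - a := by linarith [t.2.1]
    calc L * dist Y Z * (b - t) ≤ L * dist Y Z * (b - a) := by gcongr
      _ = L * (b - a) * dist Y Z := by ring
  have : Nonempty C(Icc a b, Fin n → ℝ) := ⟨0⟩
  have hfix := hcontr.fixedPoint_isFixedPt
  set Y := ContractingWith.fixedPoint Φ hcontr
  refine ⟨IccExtend hab Y, hext Y, fun t ht => ?_⟩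
  rw [IccExtend_of_mem hab _ ht]
  exact (DFunLike.congr_fun hfix ⟨t, ht⟩).symm

/-- Truncation of a real number to the interval `[-r, r]`. -/
noncomputable def clamp (r x : ℝ) : ℝ := max (-r) (min r x)

theorem abs_clamp_le {r : ℝ} (hr : 0 ≤ r) (x : ℝ) : |clamp r x| ≤ r :=
  abs_le.2 ⟨le_max_left _ _, max_le (by linarith) (min_le_left _ _)⟩

theorem clamp_of_abs_le {r x : ℝ} (h : |x| ≤ r) : clamp r x = x := by
  rw [clamp, min_eq_right (abs_le.1 h).2, max_eq_right (abs_le.1 h).1]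

theorem abs_clamp_sub_clamp_le (r x y : ℝ) : |clamp r x - clamp r y| ≤ |x - y| := by
  refine (abs_max_sub_max_le_max _ _ _ _).trans (max_le (by simp) ?_)
  exact (abs_min_sub_min_le_max _ _ _ _).trans (max_le (by simp) le_rfl)

/-- The driver of the transformed Riccati system, in terms of the time to maturity `τ = T - t`
and of the values `l`, `r` of the coefficients `lam`, `ρ`. -/
noncomputable def riccatiDriver (e γ τ l r : ℝ) (y : Fin 3 → ℝ) : Fin 3 → ℝ :=
  ![τ ^ 2 * l - e * (y 0 / τ - γ * (τ + y 1)) ^ 2 + 2 * γ * (τ + y 1),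
    -(r * (τ + y 1)) + e * (γ * y 2 - y 1 / τ) * (y 0 / τ - γ * (τ + y 1)) + γ * y 2,
    -(2 * r * y 2) - e * (γ * y 2 - y 1 / τ) ^ 2]

theorem abs_mul_le_mul_of_abs_le {c x C X : ℝ} (hc : |c| ≤ C) (hx : |x| ≤ X) :
    |c * x| ≤ C * X := by
  rw [abs_mul]
  exact mul_le_mul hc hx (abs_nonneg _) ((abs_nonneg _).trans hc)

section Estimates

variable {e γ τ l r K R : ℝ}

theorem abs_div_sub_mul_le (hγ : 0 ≤ γ) (hτ : 0 < τ) (hτ1 : τ ≤ 1) (hR : 0 ≤ R) {h g : ℝ}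
    (hh : |h| ≤ R * τ ^ 2) (hg : |g| ≤ R * τ ^ 2) :
    |h / τ - γ * (τ + g)| ≤ (1 + γ) * (1 + R) * τ := by
  have h1 : |h / τ| ≤ R * τ := by
    rw [abs_div, abs_of_pos hτ, div_le_iff₀ hτ]; linarith
  have h2 : |g| ≤ R * τ := hg.trans (by nlinarith [mul_nonneg hR hτ.le])
  calc |h / τ - γ * (τ + g)| ≤ |h / τ| + |γ * (τ + g)| := abs_sub _ _
    _ = |h / τ| + γ * |τ + g| := by rw [abs_mul, abs_of_nonneg hγ]
    _ ≤ R * τ + γ * (τ + R * τ) := by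
      gcongr
      exact (abs_add_le _ _).trans (by rw [abs_of_pos hτ]; gcongr)
    _ ≤ (1 + γ) * (1 + R) * τ := by nlinarith

theorem abs_mul_sub_div_le (hγ : 0 ≤ γ) (hτ : 0 < τ) (hτ1 : τ ≤ 1) (hR : 0 ≤ R) {p g : ℝ}
    (hp : |p| ≤ R * τ ^ 2) (hg : |g| ≤ R * τ ^ 2) :
    |γ * p - g / τ| ≤ (1 + γ) * (1 + R) * τ := by
  have h1 : |g / τ| ≤ R * τ := by
    rw [abs_div, abs_of_pos hτ, div_le_iff₀ hτ]; linarith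
  have h2 : |p| ≤ R * τ := hp.trans (by nlinarith [mul_nonneg hR hτ.le])
  calc |γ * p - g / τ| ≤ |γ * p| + |g / τ| := abs_sub _ _
    _ = γ * |p| + |g / τ| := by rw [abs_mul, abs_of_nonneg hγ]
    _ ≤ γ * (R * τ) + R * τ := by gcongr
    _ ≤ (1 + γ) * (1 + R) * τ := by nlinarith

/-- Growth of the driver on the set `‖y‖ ≤ R τ²`. -/
theorem norm_riccatiDriver_le (he : 0 ≤ e) (hγ : 0 ≤ γ) (hτ : 0 < τ) (hτ1 : τ ≤ 1) (hR : 0 ≤ R)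
    (hl : |l| ≤ K) (hr : |r| ≤ K) {y : Fin 3 → ℝ} (hy : ∀ i, |y i| ≤ R * τ ^ 2) :
    ‖riccatiDriver e γ τ l r y‖ ≤ (2 * γ + K) * τ
      + (K + 2 * K * R + e * ((1 + γ) * (1 + R)) ^ 2 + 2 * γ * R) * τ ^ 2 := by
  have hK : 0 ≤ K := (abs_nonneg l).trans hl
  set A := (1 + γ) * (1 + R) with hA
  have hA0 : 0 ≤ A := by positivity
  have hu := abs_div_sub_mul_le hγ hτ hτ1 hR (hy 0) (hy 1)
  have hv := abs_mul_sub_div_le hγ hτ hτ1 hR (hy 2) (hy 1)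
  have hg := hy 1
  have hp := hy 2
  rw [← hA] at hu hv
  have hτ2 : 0 < τ ^ 2 := by positivity
  rw [pi_norm_le_iff_of_nonneg (by positivity)]
  intro i
  have heq : riccatiDriver e γ τ l r y i = ![τ ^ 2 * l - e * (y 0 / τ - γ * (τ + y 1)) ^ 2
      + 2 * γ * (τ + y 1), -(r * (τ + y 1)) + e * (γ * y 2 - y 1 / τ)
      * (y 0 / τ - γ * (τ + y 1)) + γ * y 2,
      -(2 * r * y 2) - e * (γ * y 2 - y 1 / τ) ^ 2] i := rfl
  rw [heq, Real.norm_eq_abs]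
  generalize y 0 / τ - γ * (τ + y 1) = u at *
  generalize γ * y 2 - y 1 / τ = v at *
  have hg' : |τ + y 1| ≤ τ + R * τ ^ 2 :=
    (abs_add_le _ _).trans (by rw [abs_of_pos hτ]; gcongr)
  have hprod : ∀ x z : ℝ, |x| ≤ A * τ → |z| ≤ A * τ → |e * (x * z)| ≤ e * A ^ 2 * τ ^ 2 := by
    intro x z hx hz
    calc |e * (x * z)| = e * (|x| * |z|) := by rw [abs_mul, abs_mul, abs_of_nonneg he]
      _ ≤ e * ((A * τ) * (A * τ)) := by gcongr
      _ = _ := by ring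
  have huu := abs_le.1 (hprod u u hu hu)
  have hvu := abs_le.1 (hprod v u hv hu)
  have hvv := abs_le.1 (hprod v v hv hv)
  have h1 := abs_le.1 (abs_mul_le_mul_of_abs_le hl (abs_of_pos hτ2).le)
  have h2 := abs_le.1 (abs_mul_le_mul_of_abs_le (abs_of_nonneg hγ).le hg')
  have h3 := abs_le.1 (abs_mul_le_mul_of_abs_le hr hg')
  have h4 := abs_le.1 (abs_mul_le_mul_of_abs_le (abs_of_nonneg hγ).le hp)
  have h5 := abs_le.1 (abs_mul_le_mul_of_abs_le hr hp)
  have n1 : 0 ≤ K * R * τ ^ 2 := by positivity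
  have n2 : 0 ≤ γ * R * τ ^ 2 := by positivity
  have n3 : 0 ≤ K * τ := by positivity
  have n4 : 0 ≤ γ * τ := by positivity
  have n5 : 0 ≤ K * τ ^ 2 := by positivity
  fin_cases i <;> simp <;> rw [abs_le] <;> constructor <;> linarith

/-- Lipschitz continuity of the driver on the set `‖y‖ ≤ R τ²`. -/
theorem norm_riccatiDriver_sub_le (he : 0 ≤ e) (hγ : 0 ≤ γ) (hτ : 0 < τ) (hτ1 : τ ≤ 1)
    (hR : 0 ≤ R) (hr : |r| ≤ K) {y z : Fin 3 → ℝ} {d : ℝ} (hy : ∀ i, |y i| ≤ R * τ ^ 2)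
    (hz : ∀ i, |z i| ≤ R * τ ^ 2) (hd : ∀ i, |y i - z i| ≤ d) :
    ‖riccatiDriver e γ τ l r y - riccatiDriver e γ τ l r z‖ ≤
      (2 * e * ((1 + γ) * (1 + R)) * (1 + γ) + 2 * γ + 2 * K) * d := by
  have hK : 0 ≤ K := (abs_nonneg r).trans hr
  have hd0 : 0 ≤ d := (abs_nonneg _).trans (hd 0)
  set A := (1 + γ) * (1 + R) with hA
  have hA0 : 0 ≤ A := by positivity
  have hu := abs_div_sub_mul_le hγ hτ hτ1 hR (hy 0) (hy 1)
  have hv := abs_mul_sub_div_le hγ hτ hτ1 hR (hy 2) (hy 1)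
  have hu' := abs_div_sub_mul_le hγ hτ hτ1 hR (hz 0) (hz 1)
  have hv' := abs_mul_sub_div_le hγ hτ hτ1 hR (hz 2) (hz 1)
  have hdτ : d ≤ d / τ := by rw [le_div_iff₀ hτ]; nlinarith
  have hdiv : ∀ i, |(y i - z i) / τ| ≤ d / τ := by
    intro i
    rw [abs_div, abs_of_pos hτ]
    exact div_le_div_of_nonneg_right (hd i) hτ.le
  have hγd : ∀ i, |γ * (y i - z i)| ≤ γ * d := fun i =>
    abs_mul_le_mul_of_abs_le (abs_of_nonneg hγ).le (hd i)
  have hdu : |(y 0 / τ - γ * (τ + y 1)) - (z 0 / τ - γ * (τ + z 1))| ≤ (1 + γ) * (d / τ) := by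
    calc _ = |(y 0 - z 0) / τ - γ * (y 1 - z 1)| := by congr 1; ring
      _ ≤ d / τ + γ * d := (abs_sub _ _).trans (add_le_add (hdiv 0) (hγd 1))
      _ ≤ _ := by nlinarith
  have hdv : |(γ * y 2 - y 1 / τ) - (γ * z 2 - z 1 / τ)| ≤ (1 + γ) * (d / τ) := by
    calc _ = |γ * (y 2 - z 2) - (y 1 - z 1) / τ| := by congr 1; ring
      _ ≤ γ * d + d / τ := (abs_sub _ _).trans (add_le_add (hγd 2) (hdiv 1))
      _ ≤ _ := by nlinarith
  rw [← hA] at hu hv hu' hv'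
  rw [pi_norm_le_iff_of_nonneg (by positivity)]
  intro i
  have heq : ∀ y, riccatiDriver e γ τ l r y i = ![τ ^ 2 * l - e * (y 0 / τ - γ * (τ + y 1)) ^ 2
      + 2 * γ * (τ + y 1), -(r * (τ + y 1)) + e * (γ * y 2 - y 1 / τ)
      * (y 0 / τ - γ * (τ + y 1)) + γ * y 2,
      -(2 * r * y 2) - e * (γ * y 2 - y 1 / τ) ^ 2] i := fun _ => rfl
  rw [Pi.sub_apply, heq, heq, Real.norm_eq_abs]
  generalize y 0 / τ - γ * (τ + y 1) = u at *
  generalize γ * y 2 - y 1 / τ = v at *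
  generalize z 0 / τ - γ * (τ + z 1) = u' at *
  generalize γ * z 2 - z 1 / τ = v' at *
  have hprod : ∀ a b a' b' : ℝ, |b| ≤ A * τ → |a'| ≤ A * τ → |a - a'| ≤ (1 + γ) * (d / τ) →
      |b - b'| ≤ (1 + γ) * (d / τ) → |e * (a * b - a' * b')| ≤ 2 * e * A * (1 + γ) * d := by
    intro a b a' b' hb ha' hab hbb
    calc |e * (a * b - a' * b')| = e * |(a - a') * b + a' * (b - b')| := by
          rw [abs_mul, abs_of_nonneg he]; congr 2; ring
      _ ≤ e * ((1 + γ) * (d / τ) * (A * τ) + A * τ * ((1 + γ) * (d / τ))) := by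
          gcongr
          exact (abs_add_le _ _).trans (add_le_add (abs_mul_le_mul_of_abs_le hab hb)
            (abs_mul_le_mul_of_abs_le ha' hbb))
      _ = _ := by field_simp; ring
  have huu := abs_le.1 (hprod u u u' u' hu hu' hdu hdu)
  have hvu := abs_le.1 (hprod v u v' u' hu hv' hdv hdu)
  have hvv := abs_le.1 (hprod v v v' v' hv hv' hdv hdv)
  have h1 := abs_le.1 (hγd 1)
  have h2 := abs_le.1 (hγd 2)
  have h3 := abs_le.1 (abs_mul_le_mul_of_abs_le hr (hd 1))
  have h4 := abs_le.1 (abs_mul_le_mul_of_abs_le hr (hd 2))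
  have n1 : 0 ≤ K * d := by positivity
  have n2 : 0 ≤ γ * d := by positivity
  have n3 : 0 ≤ e * A * (1 + γ) * d := by positivity
  fin_cases i <;> simp <;> rw [abs_le] <;> constructor <;> linarith

end Estimates

/-- Short-time existence (deterministic case) for the transformed Riccati
system: there are `δ ∈ (0,T]` and a continuous `Y` on `[T−δ,T]`, vanishing
to second order at `T`, with `Y(t) = ∫ₜᵀ f(s,Y(s)) ds`. -/
theorem stmt_10 (T η γ : ℝ) (hT : 0 < T) (hη : 0 < η) (hγ : 0 ≤ γ)
    (lam ρ : ℝ → ℝ) (hlam_meas : Measurable lam) (hρ_meas : Measurable ρ)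
    (hlam_nonneg : ∀ t ∈ Icc (0 : ℝ) T, 0 ≤ lam t)
    (hρ_nonneg : ∀ t ∈ Icc (0 : ℝ) T, 0 ≤ ρ t)
    (hlam_bdd : ∃ M : ℝ, ∀ t ∈ Icc (0 : ℝ) T, lam t ≤ M)
    (hρ_bdd : ∃ M : ℝ, ∀ t ∈ Icc (0 : ℝ) T, ρ t ≤ M) :
    let f : ℝ → (Fin 3 → ℝ) → (Fin 3 → ℝ) := fun t y =>
      ![(T - t) ^ 2 * lam t
          - η⁻¹ * (y 0 / (T - t) - γ * (T - t + y 1)) ^ 2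
          + 2 * γ * (T - t + y 1),
        -(ρ t * (T - t + y 1))
          + η⁻¹ * (γ * y 2 - y 1 / (T - t))
            * (y 0 / (T - t) - γ * (T - t + y 1))
          + γ * y 2,
        -(2 * ρ t * y 2) - η⁻¹ * (γ * y 2 - y 1 / (T - t)) ^ 2]
    ∃ δ : ℝ, 0 < δ ∧ δ ≤ T ∧ ∃ Y : ℝ → Fin 3 → ℝ,
      ContinuousOn Y (Icc (T - δ) T)
      ∧ (∃ M : ℝ, ∀ t ∈ Ico (T - δ) T, ((T - t) ^ 2)⁻¹ * ‖Y t‖ ≤ M)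
      ∧ ∀ t ∈ Icc (T - δ) T, Y t = ∫ s in t..T, f s (Y s) := by
  intro f
  obtain ⟨M₁, hM₁⟩ := hlam_bdd
  obtain ⟨M₂, hM₂⟩ := hρ_bdd
  obtain ⟨K, hK1, hKl, hKr⟩ : ∃ K : ℝ, 1 ≤ K ∧ (∀ t ∈ Icc (0 : ℝ) T, |lam t| ≤ K) ∧
      ∀ t ∈ Icc (0 : ℝ) T, |ρ t| ≤ K := by
    refine ⟨max 1 (max M₁ M₂), le_max_left _ _, fun t ht => ?_, fun t ht => ?_⟩
    · rw [abs_of_nonneg (hlam_nonneg t ht)]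
      exact (hM₁ t ht).trans ((le_max_left _ _).trans (le_max_right _ _))
    · rw [abs_of_nonneg (hρ_nonneg t ht)]
      exact (hM₂ t ht).trans ((le_max_right _ _).trans (le_max_right _ _))
  have he : 0 ≤ η⁻¹ := (inv_pos.2 hη).le
  have hK : 0 ≤ K := by linarith
  obtain ⟨R, hRdef⟩ : ∃ R, R = 2 * γ + K := ⟨_, rfl⟩
  have hR : 0 < R := by linarith
  obtain ⟨C, hC⟩ : ∃ C, C = K + 2 * K * R + η⁻¹ * ((1 + γ) * (1 + R)) ^ 2 + 2 * γ * R := ⟨_, rfl⟩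
  obtain ⟨L, hLdef⟩ : ∃ L, L = 2 * η⁻¹ * ((1 + γ) * (1 + R)) * (1 + γ) + 2 * γ + 2 * K := ⟨_, rfl⟩
  have hC0 : 0 < C := by rw [hC]; positivity
  have hL0 : 0 < L := by rw [hLdef]; positivity
  obtain ⟨δ, hδ0, hδT, hδ1, hδC, hδL⟩ :
      ∃ δ : ℝ, 0 < δ ∧ δ ≤ T ∧ δ ≤ 1 ∧ C * δ ≤ R ∧ L * δ < 1 := by
    refine ⟨min (min T 1) (min (R / C) (1 / (2 * L))), by positivity,
      (min_le_left _ _).trans (min_le_left _ _), (min_le_left _ _).trans (min_le_right _ _), ?_, ?_⟩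
    · rw [← le_div_iff₀' hC0]
      exact (min_le_right _ _).trans (min_le_left _ _)
    · rw [← lt_div_iff₀' hL0]
      refine ((min_le_right _ _).trans (min_le_right _ _)).trans_lt ?_
      gcongr
      linarith
  let F : ℝ → (Fin 3 → ℝ) → (Fin 3 → ℝ) := fun t y => f t fun i => clamp (R * (T - t) ^ 2) (y i)
  have hclamp : ∀ t x, |clamp (R * (T - t) ^ 2) x| ≤ R * (T - t) ^ 2 := fun t x =>
    abs_clamp_le (by positivity) x
  have hF_eq : ∀ t y, F t y = riccatiDriver η⁻¹ γ (T - t) (lam t) (ρ t)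
      fun i => clamp (R * (T - t) ^ 2) (y i) := fun _ _ => rfl
  have hF_end : ∀ y, F T y = 0 := by
    intro y
    have h0 : ∀ x, clamp 0 x = 0 := fun x => abs_nonpos_iff.1 (abs_clamp_le le_rfl x)
    ext i
    fin_cases i <;> simp [F, f, h0]
  have hF_bound : ∀ t ∈ Icc (T - δ) T, ∀ y, ‖F t y‖ ≤ 2 * R * (T - t) := by
    intro t ht y
    rcases ht.2.eq_or_lt with rfl | htT
    · simp [hF_end]
    have hτ : 0 < T - t := sub_pos.2 htT
    have hτδ : T - t ≤ δ := by linarith [ht.1]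
    have ht0 : t ∈ Icc 0 T := ⟨by linarith [ht.1], ht.2⟩
    have h := norm_riccatiDriver_le he hγ hτ (hτδ.trans hδ1) hR.le (hKl t ht0) (hKr t ht0)
      (fun i => hclamp t (y i))
    rw [← hRdef, ← hC] at h
    rw [hF_eq]
    refine h.trans ?_
    have h2 : C * (T - t) ≤ R := (mul_le_mul_of_nonneg_left hτδ hC0.le).trans hδC
    nlinarith
  have hF_lip : ∀ t ∈ Icc (T - δ) T, ∀ y z, ‖F t y - F t z‖ ≤ L * ‖y - z‖ := by
    intro t ht y z
    rcases ht.2.eq_or_lt with rfl | htT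
    · rw [hF_end, hF_end, sub_self, norm_zero]
      positivity
    have hτ : 0 < T - t := sub_pos.2 htT
    have ht0 : t ∈ Icc 0 T := ⟨by linarith [ht.1], ht.2⟩
    rw [hLdef, hF_eq, hF_eq]
    exact norm_riccatiDriver_sub_le (l := lam t) he hγ hτ (by linarith [ht.1]) hR.le (hKr t ht0)
      (fun i => hclamp t (y i)) (fun i => hclamp t (z i))
      (fun i => (abs_clamp_sub_clamp_le _ _ _).trans (norm_le_pi_norm (y - z) i))
  have hF_meas : Measurable (Function.uncurry F) := by
    refine measurable_pi_lambda _ fun i => ?_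
    fin_cases i <;> simp only [Function.uncurry_def, F, f, clamp] <;> simp <;> fun_prop
  obtain ⟨Y, hYc, hY⟩ := exists_continuous_eq_integral_of_lipschitz (by linarith) F hF_meas
    (M := 2 * R * δ) hL0.le (by simpa using hδL) hF_lip
    (fun t ht y => (hF_bound t ht y).trans (by gcongr; linarith [ht.1]))
  have hYn : ∀ t ∈ Icc (T - δ) T, ‖Y t‖ ≤ R * (T - t) ^ 2 := by
    intro t ht
    have hI : ∫ s in t..T, 2 * R * (T - s) = R * (T - t) ^ 2 := by
      rw [intervalIntegral.integral_const_mul, intervalIntegral.integral_comp_sub_left (fun x => x)]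
      simp
      ring
    rw [hY t ht, ← hI]
    refine intervalIntegral.norm_integral_le_of_norm_le ht.2 ?_
      (Continuous.intervalIntegrable (by fun_prop) _ _)
    exact ae_of_all _ fun s hs => hF_bound s ⟨ht.1.trans hs.1.le, hs.2⟩ _
  refine ⟨δ, hδ0, hδT, Y, hYc.continuousOn, ⟨R, fun t ht => ?_⟩, fun t ht => ?_⟩
  · have hτ : 0 < T - t := sub_pos.2 ht.2
    rw [inv_mul_le_iff₀ (by positivity)]
    linarith [hYn t ⟨ht.1, ht.2.le⟩]
  · refine (hY t ht).trans (intervalIntegral.integral_congr fun s hs => ?_)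
    rw [uIcc_of_le ht.2] at hs
    have hs' := hYn s ⟨ht.1.trans hs.1, hs.2⟩
    have hcl : (fun i => clamp (R * (T - s) ^ 2) (Y s i)) = Y s :=
      funext fun i => clamp_of_abs_le ((norm_le_pi_norm (Y s) i).trans hs')
    change f s (fun i => clamp (R * (T - s) ^ 2) (Y s i)) = f s (Y s)
    rw [hcl]
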